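/- Let D ⊂ ℝ² be a connected open set, let g₁,…,g_N : D → ℝ be real-analytic functions that are linearly independent as functions on D, and let μ be a measure on D that is absolutely continuous with respect to Lebesgue measure (μ = φ·Leb with a probability density φ on D). Then the set of N-tuples ((t₁),…,(t_N)) ∈ D^N for which the N×N matrix [g_j(t_i)] is singular has μ^⊗N-measure zero; equivalently, N points drawn independently with density φ are almost surely unisolvent for interpolation in span(g₁,…,g_N). -/

import Mathlib

open MeasureTheory

section

open Set Filter Topology

variable {E : Type*} [NormedAddCommGroup E] [NormedSpace ℝ E]

/-- The zeros in an open set of a continuous function form a measurable set. -/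
theorem ContinuousOn.measurableSet_zeros {X : Type*} [TopologicalSpace X] [MeasurableSpace X]
    [OpensMeasurableSpace X] {U : Set X} (hU : IsOpen U) {f : X → ℝ} (hf : ContinuousOn f U) :
    MeasurableSet {x | x ∈ U ∧ f x = 0} := by
  have h : {x | x ∈ U ∧ f x = 0} = U \ (U ∩ f ⁻¹' {0}ᶜ) := by
    ext x
    by_cases hx : x ∈ U <;> simp [hx]
  rw [h]
  exact hU.measurableSet.diff
    (hf.isOpen_inter_preimage hU isOpen_compl_singleton).measurableSet

/-- If an analytic function on a convex set does not vanish at `p`, its zeros on every line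
through `p` are negligible. -/
theorem AnalyticOnNhd.ae_line_ne_zero {B : Set E} (hBo : IsOpen B) (hBc : Convex ℝ B)
    {f : E → ℝ} (hf : AnalyticOnNhd ℝ f B) {p : E} (hp : p ∈ B) (hfp : f p ≠ 0) (v : E) :
    ∀ᵐ t : ℝ, ¬ (p + t • v ∈ B ∧ f (p + t • v) = 0) := by
  let l : ℝ → E := fun t => p + t • v
  have hl : Continuous l := by fun_prop
  have hla : ∀ t, AnalyticAt ℝ l t := fun t => by fun_prop
  have hIc : Convex ℝ (l ⁻¹' B) := by
    intro a ha b hb s t hs ht hst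
    have h := hBc ha hb hs ht hst
    have e : s • l a + t • l b = l (s • a + t • b) := by
      have : p = (s + t) • p := by rw [hst, one_smul]
      simp only [l, smul_add, smul_eq_mul, add_smul, mul_smul]
      nth_rewrite 3 [this]
      rw [add_smul]
      abel
    rwa [e] at h
  have h0 : (0 : ℝ) ∈ l ⁻¹' B := by simpa [l] using hp
  have hI : AnalyticOnNhd ℝ (f ∘ l) (l ⁻¹' B) := fun t ht => (hf _ ht).comp (hla t)
  have hz := hI.preimage_zero_mem_codiscreteWithin (x := 0) (by simpa [l] using hfp) h0
    ⟨⟨0, h0⟩, hIc.isPreconnected⟩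
  have hm := ae_restrict_le_codiscreteWithin (μ := volume) (hBo.preimage hl).measurableSet hz
  have hm' := (ae_restrict_iff' (hBo.preimage hl).measurableSet).1 hm
  filter_upwards [hm'] with t ht h
  exact ht h.1 h.2

variable [FiniteDimensional ℝ E] [MeasurableSpace E] [BorelSpace E]
  (ν : Measure E) [ν.IsAddHaarMeasure]

/-- The zero set of an analytic function on an open convex set is negligible as soon as the
function does not vanish at some point. -/
theorem AnalyticOnNhd.measure_zeros_of_convex {B : Set E} (hBo : IsOpen B) (hBc : Convex ℝ B)
    {f : E → ℝ} (hf : AnalyticOnNhd ℝ f B) {p : E} (hp : p ∈ B) (hfp : f p ≠ 0) :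
    ν {x | x ∈ B ∧ f x = 0} = 0 := by
  have hZ := hf.continuousOn.measurableSet_zeros hBo
  have hmeas : MeasurableSet {q : E × ℝ | ¬ (p + q.2 • q.1 ∈ B ∧ f (p + q.2 • q.1) = 0)} := by
    have hc : Measurable fun q : E × ℝ => p + q.2 • q.1 :=
      Continuous.measurable (by fun_prop)
    exact (hc hZ).compl
  have h1 : ∀ᵐ v ∂ν, ∀ᵐ t : ℝ, ¬ (p + t • v ∈ B ∧ f (p + t • v) = 0) :=
    Eventually.of_forall fun v => hf.ae_line_ne_zero hBo hBc hp hfp v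
  have h2 := (Measure.ae_ae_comm hmeas).1 h1
  obtain ⟨t, ht, ht0⟩ := (h2.and (Measure.ae_ne volume (0 : ℝ))).exists
  have h3 : ν ((t • ·) ⁻¹' ((p + ·) ⁻¹' {x | x ∈ B ∧ f x = 0})) = 0 := by
    simpa [ae_iff] using ht
  rw [Measure.addHaar_preimage_smul ν ht0, measure_preimage_add, mul_eq_zero] at h3
  refine h3.resolve_left ?_
  simp [ht0]

/-- The zero set of an analytic function that does not vanish identically on a connected open
set is negligible. -/
theorem AnalyticOnNhd.measure_zeros {D : Set E} (hDo : IsOpen D) (hDc : IsPreconnected D)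
    {f : E → ℝ} (hf : AnalyticOnNhd ℝ f D) (hne : ¬ EqOn f 0 D) :
    ν {x | x ∈ D ∧ f x = 0} = 0 := by
  refine measure_null_of_locally_null _ fun x hx => ?_
  obtain ⟨r, hr, hrD⟩ := Metric.isOpen_iff.1 hDo x hx.1
  obtain ⟨p, hp, hfp⟩ : ∃ p ∈ Metric.ball x r, f p ≠ 0 := by
    by_contra! h
    exact hne (hf.eqOn_zero_of_preconnected_of_eventuallyEq_zero hDc hx.1
      (eventually_of_mem (Metric.ball_mem_nhds x hr) h))
  refine ⟨{y | y ∈ Metric.ball x r ∧ f y = 0}, ?_,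
    (hf.mono hrD).measure_zeros_of_convex ν Metric.isOpen_ball (convex_ball x r) hp hfp⟩
  filter_upwards [self_mem_nhdsWithin, mem_nhdsWithin_of_mem_nhds (Metric.ball_mem_nhds x hr)]
    with y hy hyr using ⟨hyr, hy.2⟩

/-- For linearly independent analytic functions on a connected open set, almost every tuple of
points of the set is unisolvent. -/
theorem ae_det_ne_zero_of_linearIndependent {D : Set E} (hDo : IsOpen D)
    (hDc : IsPreconnected D) {μ : Measure E} [SigmaFinite μ] (hμ : μ ≪ ν) {n : ℕ}
    (g : Fin n → E → ℝ) (hg : ∀ j, AnalyticOnNhd ℝ (g j) D)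
    (hli : LinearIndependent ℝ (fun j => D.domRestrict (g j))) :
    ∀ᵐ t ∂Measure.pi (fun _ : Fin n => μ),
      ¬ ((∀ i, t i ∈ D) ∧ (Matrix.of fun i j => g j (t i)).det = 0) := by
  induction n with
  | zero => simp
  | succ n ih =>
    have hprev := ih (fun j => g j.succ) (fun j => hg _)
      (hli.comp Fin.succ (Fin.succ_injective n))
    have hU : IsOpen {t : Fin (n + 1) → E | ∀ i, t i ∈ D} := by
      simp only [ofPred_forall]
      exact isOpen_iInter_of_finite fun i => hDo.preimage (continuous_apply i)
    have hcont : ContinuousOn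
        (fun t : Fin (n + 1) → E => (Matrix.of fun i j => g j (t i)).det)
        {t | ∀ i, t i ∈ D} := by
      simp only [Matrix.det_apply, Matrix.of_apply]
      refine continuousOn_finsetSum _ fun σ _ => ContinuousOn.const_smul ?_ _
      refine continuousOn_finsetProd _ fun i _ => ?_
      exact (hg i).continuousOn.comp (continuous_apply _).continuousOn fun t ht => ht _
    have hS := hcont.measurableSet_zeros hU
    have hcons : Measurable fun q : E × (Fin n → E) => (Fin.cons q.1 q.2 : Fin (n + 1) → E) :=
      Continuous.measurable (by fun_prop)
    have hfub : ∀ᵐ s ∂Measure.pi (fun _ : Fin n => μ), ∀ᵐ x ∂μ,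
        ¬ ((∀ i, (Fin.cons x s : Fin (n + 1) → E) i ∈ D) ∧
          (Matrix.of fun i j => g j ((Fin.cons x s : Fin (n + 1) → E) i)).det = 0) := by
      filter_upwards [hprev] with s hs
      by_cases hsD : ∀ i, s i ∈ D
      swap
      · refine Eventually.of_forall fun x hx => hsD fun i => ?_
        simpa using hx.1 i.succ
      let c : Fin (n + 1) → ℝ := fun j =>
        (-1) ^ (j : ℕ) * (Matrix.of fun (i k : Fin n) => g (j.succAbove k) (s i)).det
      have hc0 : c 0 ≠ 0 := by
        have h : (Matrix.of fun (i k : Fin n) => g k.succ (s i)).det ≠ 0 := fun h => hs ⟨hsD, h⟩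
        simpa [c] using h
      have hdet : ∀ x, (Matrix.of fun i j => g j ((Fin.cons x s : Fin (n + 1) → E) i)).det
          = ∑ j, c j * g j x := by
        intro x
        rw [Matrix.det_succ_row_zero]
        refine Finset.sum_congr rfl fun j _ => ?_
        have h : (Matrix.of fun i j => g j ((Fin.cons x s : Fin (n + 1) → E) i)).submatrix
            Fin.succ j.succAbove = Matrix.of fun (i k : Fin n) => g (j.succAbove k) (s i) := by
          ext i k
          simp
        rw [h]
        simp only [c, Matrix.of_apply, Fin.cons_zero]
        ring
      have han : AnalyticOnNhd ℝ (fun x => ∑ j, c j * g j x) D := fun x hx =>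
        Finset.analyticAt_fun_sum _ fun j _ => analyticAt_const.mul (hg j x hx)
      have hne : ¬ EqOn (fun x => ∑ j, c j * g j x) 0 D := by
        intro h
        refine hc0 (Fintype.linearIndependent_iff.1 hli c ?_ 0)
        ext x
        simpa [Set.domRestrict_apply] using h x.2
      have hnull := hμ (han.measure_zeros ν hDo hDc hne)
      filter_upwards [measure_eq_zero_iff_ae_notMem.1 hnull] with x hx hx'
      exact hx ⟨by simpa using hx'.1 0, by rw [← hdet]; exact hx'.2⟩
    have hfub' := (Measure.ae_ae_comm (hcons hS).compl).2 hfub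
    have hprod := (Measure.ae_prod_iff_ae_ae (hcons hS).compl).2 hfub'
    have hmp := measurePreserving_piFinSuccAbove (fun _ : Fin (n + 1) => μ) 0
    filter_upwards [hmp.quasiMeasurePreserving.ae hprod] with t ht
    have e : (Fin.cons (t 0) (fun i : Fin n => t i.succ) : Fin (n + 1) → E) = t :=
      Fin.cons_self_tail t
    simpa [MeasurableEquiv.piFinSuccAbove, Fin.removeNth, Fin.tail, e] using ht

end

/-- Let `D ⊂ ℝ²` be a connected open set, `g₁,…,g_N` real-analytic on `D` and
linearly independent as functions on `D`, and `μ = φ·Leb` a probability measure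
with density `φ` supported on `D`. Then the set of `N`-tuples of points of `D`
for which the Vandermonde-like matrix `[g_j(t_i)]` is singular has
`μ^⊗N`-measure zero: `N` points drawn with density `φ` are almost surely
unisolvent for interpolation in `span(g₁,…,g_N)`. -/
theorem almost_surely_unisolvent
    {N : ℕ} (D : Set (EuclideanSpace ℝ (Fin 2))) (hDopen : IsOpen D)
    (hDconn : IsConnected D)
    (g : Fin N → EuclideanSpace ℝ (Fin 2) → ℝ)
    (hg_an : ∀ j, AnalyticOnNhd ℝ (g j) D)
    (hg_li : LinearIndependent ℝ (fun j => D.restrict (g j)))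
    (φ : EuclideanSpace ℝ (Fin 2) → ENNReal) (hφ_meas : Measurable φ)
    (hφ_supp : ∀ x ∉ D, φ x = 0)
    (hφ_prob : IsProbabilityMeasure (volume.withDensity φ)) :
    Measure.pi (fun _ : Fin N => volume.withDensity φ)
      {t : Fin N → EuclideanSpace ℝ (Fin 2) |
        (∀ i, t i ∈ D) ∧ (Matrix.of fun i j => g j (t i)).det = 0} = 0 := by
  have h := ae_det_ne_zero_of_linearIndependent volume hDopen hDconn.isPreconnected
    (withDensity_absolutelyContinuous volume φ) g hg_an hg_li
  simpa only [ae_iff, not_not] using h
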